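/- For every integer d ≥ 1 and every real x > 0, one has m(x) = 1 − I(x), i.e. (2^{d/2} Γ((d+1)/2)/√π) ∫_{2πx}^∞ r^{−d/2} J_{d/2}(r) dr = 1 − (2/π) ∫₀^{2πx} (1 − (t/(2πx))²)^{(d−1)/2} (sin t)/t dt. -/

import Mathlib

open MeasureTheory Real Filter Finset

/-- Bessel function of the first kind of order `α`, via the Poisson integral representation. -/
noncomputable def besselJ (α : ℝ) (t : ℝ) : ℝ :=
  ((t / 2) ^ α / (Real.sqrt π * Real.Gamma (α + 1 / 2))) *
    ∫ θ in (0:ℝ)..π, Real.cos (t * Real.cos θ) * Real.sin θ ^ (2 * α)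

/-- The multiplier `m`, defined by an improper integral (as a limit of interval integrals). -/
noncomputable def mfun (d : ℕ) (x : ℝ) : ℝ :=
  (2 ^ ((d : ℝ) / 2) * Real.Gamma (((d : ℝ) + 1) / 2) / Real.sqrt π) *
    limUnder Filter.atTop
      (fun R : ℝ => ∫ r in (2 * π * x)..R, r ^ (-(d : ℝ) / 2) * besselJ ((d : ℝ) / 2) r)

/-- The function `I(x) = (2/π) ∫₀^{2πx} (1 − (t/(2πx))²)^{(d−1)/2} (sin t)/t dt`. -/
noncomputable def Ifun (d : ℕ) (x : ℝ) : ℝ :=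
  (2 / π) * ∫ t in (0:ℝ)..(2 * π * x),
    (1 - (t / (2 * π * x)) ^ 2) ^ (((d : ℝ) - 1) / 2) * (Real.sin t / t)

open scoped Topology

/-- The Riemann–Lebesgue lemma for the sine transform on a bounded interval. -/
lemma tendsto_intervalIntegral_mul_sin_atTop {g : ℝ → ℝ} {b : ℝ} (hb : 0 ≤ b)
    (hg : IntervalIntegrable g volume 0 b) :
    Tendsto (fun R : ℝ => ∫ s in (0:ℝ)..b, g s * sin (R * s)) atTop (𝓝 0) := by
  have hg' : Integrable ((Set.Ioc 0 b).indicator fun s => (g s : ℂ)) := by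
    rw [integrable_indicator_iff measurableSet_Ioc]
    exact ((intervalIntegrable_iff_integrableOn_Ioc_of_le hb).1 hg).ofReal
  have h1 := Real.tendsto_integral_exp_smul_cocompact
    ((Set.Ioc 0 b).indicator fun s => (g s : ℂ))
  have h2 : Tendsto (fun R : ℝ => R / (2 * π)) atTop (cocompact ℝ) :=
    (tendsto_id.atTop_div_const (by positivity)).mono_right atTop_le_cocompact
  have h3 := (Complex.continuous_im.tendsto _).comp (h1.comp h2) |>.neg
  simp only [Complex.zero_im, neg_zero] at h3
  refine h3.congr fun R => ?_
  have hint := (Real.fourierIntegral_convergent_iff (R / (2 * π))).2 hg'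
  simp only [RCLike.inner_apply, conj_trivial, mul_comm (R / (2 * π))] at hint
  simp only [Function.comp_apply]
  rw [intervalIntegral.integral_of_le hb, ← integral_indicator measurableSet_Ioc,
    ← Complex.imCLM_apply, ← Complex.imCLM.integral_comp_comm hint, ← integral_neg]
  refine integral_congr_ae (Eventually.of_forall fun s => ?_)
  by_cases hs : s ∈ Set.Ioc 0 b
  · have e : 2 * π * -(s * (R / (2 * π))) = -(R * s) := by field_simp
    simp only [Set.indicator_of_mem hs, Complex.imCLM_apply, Circle.smul_def,
      Real.fourierChar_apply, smul_eq_mul, e]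
    rw [Complex.im_mul_ofReal, Complex.exp_ofReal_mul_I_im, sin_neg]
    ring
  · simp [Set.indicator_of_notMem hs]

lemma mul_sinc_self (x : ℝ) : x * sinc x = sin x := by
  by_cases hx : x = 0
  · simp [hx]
  · rw [sinc_of_ne_zero hx, mul_div_cancel₀ _ hx]

lemma hasDerivAt_sinc_zero : HasDerivAt sinc 0 0 := by
  rw [hasDerivAt_iff_isLittleO]
  have hO : (fun x : ℝ => sinc x - sinc 0 - (x - 0) • (0:ℝ)) =O[𝓝 0] fun x : ℝ => x ^ 2 := by
    refine Asymptotics.IsBigO.of_bound 1 (Eventually.of_forall fun x => ?_)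
    by_cases hx : x = 0
    · simp [hx]
    have h := abs_sub_sin_le x
    have hx' : 0 < |x| := abs_pos.2 hx
    rw [← mul_sinc_self x, show x - x * sinc x = x * (1 - sinc x) by ring, abs_mul,
      abs_sub_comm] at h
    have : |sinc x - 1| ≤ |x| ^ 2 := by
      refine le_of_mul_le_mul_left (h.trans ?_) hx'
      nlinarith [pow_pos hx' 3]
    simpa using this
  refine hO.trans_isLittleO ?_
  simpa using Asymptotics.isLittleO_pow_id (𝕜 := ℝ) (n := 2) (by norm_num)

/-- Replacing a weight by its value at `0` does not change the limit of its integral against the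
dilated sinc kernel. -/
lemma tendsto_integral_mul_sinc_sub {φ : ℝ → ℝ} {b : ℝ} (hb : 0 < b)
    (hφ : ContinuousOn φ (Set.Icc (-b) b)) (hφ0 : DifferentiableAt ℝ φ 0) :
    Tendsto (fun R : ℝ => (∫ s in (0:ℝ)..b, φ s * (R * sinc (R * s))) -
      φ 0 * ∫ s in (0:ℝ)..R * b, sinc s) atTop (𝓝 0) := by
  have hd : ContinuousOn (dslope φ 0) (Set.Icc (-b) b) :=
    (continuousOn_dslope (Icc_mem_nhds (by linarith) hb)).2 ⟨hφ, hφ0⟩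
  have hsub : Set.uIcc 0 b ⊆ Set.Icc (-b) b := by
    rw [Set.uIcc_of_le hb.le]; exact Set.Icc_subset_Icc_left (by linarith)
  refine (tendsto_intervalIntegral_mul_sin_atTop hb.le
    (hd.mono hsub).intervalIntegrable).congr fun R => ?_
  have hS : ∫ s in (0:ℝ)..R * b, sinc s = ∫ s in (0:ℝ)..b, R * sinc (R * s) := by
    have := intervalIntegral.mul_integral_comp_mul_left (a := 0) (b := b) (f := sinc) R
    rw [intervalIntegral.integral_const_mul, this, mul_zero]
  rw [hS, ← intervalIntegral.integral_const_mul, ← intervalIntegral.integral_sub]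
  · refine intervalIntegral.integral_congr fun s _ => ?_
    have h := sub_smul_dslope φ 0 s
    simp only [sub_zero, smul_eq_mul] at h
    rw [← mul_sinc_self (R * s), ← sub_mul, ← h]
    ring
  · exact ((hφ.mono hsub).mul (by fun_prop)).intervalIntegrable
  · exact Continuous.intervalIntegrable (by fun_prop) _ _

lemma sinc_ne_zero {x : ℝ} (h : |x| < π) : sinc x ≠ 0 := by
  obtain ⟨h1, h2⟩ := abs_lt.1 h
  by_cases hx : x = 0
  · simp [hx]
  · rw [sinc_of_ne_zero hx]
    exact div_ne_zero (fun h0 => hx ((sin_eq_zero_iff_of_lt_of_lt h1 h2).1 h0)) hx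

/-- The integral of the Dirichlet kernel. -/
lemma integral_inv_sinc_mul_sinc (n : ℕ) :
    ∫ s in (0:ℝ)..π / 2, (sinc s)⁻¹ * ((2 * n + 1) * sinc ((2 * n + 1) * s)) = π / 2 := by
  have hcont : ∀ c : ℝ, IntervalIntegrable (fun s => (sinc s)⁻¹ * (c * sinc (c * s)))
      volume 0 (π / 2) := fun c => by
    refine ContinuousOn.intervalIntegrable ?_
    refine (continuous_sinc.continuousOn.inv₀ fun s hs => sinc_ne_zero ?_).mul (by fun_prop)
    rw [Set.uIcc_of_le (by positivity)] at hs
    rw [abs_of_nonneg hs.1]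
    linarith [hs.2, pi_pos]
  induction n with
  | zero =>
    have : ∫ _ in (0:ℝ)..π / 2, (1:ℝ) = π / 2 := by simp
    refine Eq.trans ?_ this
    refine intervalIntegral.integral_congr fun s hs => ?_
    rw [Set.uIcc_of_le (by positivity)] at hs
    have : sinc s ≠ 0 := sinc_ne_zero (by rw [abs_of_nonneg hs.1]; linarith [hs.2, pi_pos])
    simp [this]
  | succ n ih =>
    refine Eq.trans ?_ ih
    rw [← sub_eq_zero, ← intervalIntegral.integral_sub (hcont _) (hcont _)]
    have hz : ∫ s in (0:ℝ)..π / 2, 2 * cos ((2 * n + 2) * s) = 0 := by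
      rw [intervalIntegral.integral_const_mul,
        intervalIntegral.integral_comp_mul_left _ (by positivity : (2 * (n:ℝ) + 2) ≠ 0),
        integral_cos, show (2 * (n:ℝ) + 2) * (π / 2) = (n + 1 : ℕ) * π by push_cast; ring,
        sin_nat_mul_pi]
      simp
    refine Eq.trans ?_ hz
    refine intervalIntegral.integral_congr fun s hs => ?_
    rw [Set.uIcc_of_le (by positivity)] at hs
    have h0 : sinc s ≠ 0 := sinc_ne_zero (by rw [abs_of_nonneg hs.1]; linarith [hs.2, pi_pos])
    by_cases hs0 : s = 0
    · simp [hs0]; ring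
    rw [← mul_sub, inv_mul_eq_iff_eq_mul₀ h0]
    refine mul_left_cancel₀ hs0 ?_
    push_cast
    have e1 := mul_sinc_self ((2 * (n + 1) + 1) * s)
    have e2 := mul_sinc_self ((2 * n + 1) * s)
    have e3 := mul_sinc_self s
    have e4 : sin ((2 * (n + 1) + 1) * s) - sin ((2 * n + 1) * s)
        = sin s * (2 * cos ((2 * n + 2) * s)) := by
      rw [sin_sub_sin]
      ring_nf
    linear_combination e1 - e2 + e4 - 2 * cos ((2 * n + 2) * s) * e3

/-- The Dirichlet integral. -/
lemma tendsto_integral_sinc_atTop :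
    Tendsto (fun T : ℝ => ∫ s in (0:ℝ)..T, sinc s) atTop (𝓝 (π / 2)) := by
  have h1 := tendsto_integral_mul_sinc_sub (φ := fun s => (sinc s)⁻¹) (b := π / 2)
    (by positivity)
    (continuous_sinc.continuousOn.inv₀ fun s hs => sinc_ne_zero <| by
      have := abs_le.2 hs
      linarith [pi_pos])
    (hasDerivAt_sinc_zero.differentiableAt.inv (by simp))
  have hf : Tendsto (fun T : ℝ => 2 * ((⌊T / π⌋₊ : ℕ) : ℝ) + 1) atTop atTop := by
    refine tendsto_atTop_add_const_right _ _ (Tendsto.const_mul_atTop two_pos ?_)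
    exact tendsto_natCast_atTop_atTop.comp
      (tendsto_nat_floor_atTop.comp (tendsto_id.atTop_div_const pi_pos))
  have h2 := h1.comp hf
  have h3 : Tendsto (fun T : ℝ => ∫ s in (2 * ((⌊T / π⌋₊ : ℕ) : ℝ) + 1) * (π / 2)..T, sinc s)
      atTop (𝓝 0) := by
    have hlim : Tendsto (fun T : ℝ => (T - π / 2)⁻¹ * (π / 2)) atTop (𝓝 0) := by
      have : Tendsto (fun T : ℝ => (T - π / 2)⁻¹) atTop (𝓝 0) :=
        tendsto_inv_atTop_zero.comp (tendsto_atTop_add_const_right _ _ tendsto_id)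
      simpa using this.mul_const (π / 2)
    refine squeeze_zero_norm' ?_ hlim
    filter_upwards [eventually_gt_atTop (π / 2)] with T hT
    have hT0 : 0 < T - π / 2 := by linarith
    have f1 := Nat.floor_le (show 0 ≤ T / π from div_nonneg (by linarith [pi_pos]) pi_pos.le)
    have f2 := Nat.lt_floor_add_one (T / π)
    rw [le_div_iff₀ pi_pos] at f1
    rw [div_lt_iff₀ pi_pos] at f2
    set k : ℝ := ((⌊T / π⌋₊ : ℕ) : ℝ)
    have f3 : |T - (2 * k + 1) * (π / 2)| ≤ π / 2 := by rw [abs_le]; constructor <;> nlinarith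
    refine (intervalIntegral.norm_integral_le_of_norm_le_const (C := (T - π / 2)⁻¹) ?_).trans ?_
    · intro s hs
      have hs1 : T - π / 2 ≤ s := by
        have := hs.1.le
        rw [abs_le] at f3
        refine le_trans (le_min ?_ ?_) this <;> linarith [pi_pos]
      have hs0 : 0 < s := hT0.trans_le hs1
      rw [sinc_of_ne_zero hs0.ne', norm_eq_abs, abs_div, abs_of_pos hs0, div_eq_mul_inv]
      calc |sin s| * s⁻¹ ≤ 1 * (T - π / 2)⁻¹ := by
            gcongr
            exact abs_sin_le_one s
        _ = _ := one_mul _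
    · gcongr
  have h4 := (h3.sub h2).add_const (π / 2)
  simp only [sub_zero, zero_add] at h4
  refine h4.congr fun T => ?_
  simp only [Function.comp_apply]
  rw [integral_inv_sinc_mul_sinc, sinc_zero, inv_one, one_mul]
  have := intervalIntegral.integral_add_adjacent_intervals
    (continuous_sinc.intervalIntegrable (μ := volume) 0
      ((2 * ((⌊T / π⌋₊ : ℕ) : ℝ) + 1) * (π / 2)))
    (continuous_sinc.intervalIntegrable _ T)
  linarith

lemma integral_cos_mul_eq_sinc (a R s : ℝ) :
    ∫ r in a..R, cos (r * s) = R * sinc (R * s) - a * sinc (a * s) := by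
  by_cases hs : s = 0
  · simp [hs]
  · rw [intervalIntegral.integral_comp_mul_right _ hs, integral_cos, smul_eq_mul,
      inv_mul_eq_iff_eq_mul₀ hs, ← mul_sinc_self, ← mul_sinc_self]
    ring

/-- The weight `(1 - s ^ 2) ^ ((d - 1) / 2)`. -/
noncomputable def besselWeight (d : ℕ) (s : ℝ) : ℝ := (1 - s ^ 2) ^ (((d : ℝ) - 1) / 2)

lemma continuous_besselWeight {d : ℕ} (hd : 1 ≤ d) : Continuous (besselWeight d) := by
  have : (1:ℝ) ≤ d := by exact_mod_cast hd
  exact (by fun_prop : Continuous fun s : ℝ => 1 - s ^ 2).rpow_const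
    fun _ => Or.inr (by linarith)

lemma differentiableAt_besselWeight_zero (d : ℕ) : DifferentiableAt ℝ (besselWeight d) 0 :=
  (by fun_prop : DifferentiableAt ℝ (fun s : ℝ => 1 - s ^ 2) 0).rpow_const (Or.inl (by norm_num))

lemma besselWeight_zero (d : ℕ) : besselWeight d 0 = 1 := by simp [besselWeight]

lemma besselWeight_neg (d : ℕ) (s : ℝ) : besselWeight d (-s) = besselWeight d s := by
  simp [besselWeight]

lemma besselWeight_cos_mul_sin {d : ℕ} (hd : 1 ≤ d) {θ : ℝ} (hθ : 0 ≤ sin θ) :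
    besselWeight d (cos θ) * sin θ = sin θ ^ (2 * ((d : ℝ) / 2)) := by
  have hd' : (d : ℝ) - 1 = ((d - 1 : ℕ) : ℝ) := by push_cast [hd]; ring
  rw [besselWeight, ← sin_sq, ← rpow_natCast (sin θ) 2, ← rpow_mul hθ]
  rw [show ((2 : ℕ) : ℝ) * (((d : ℝ) - 1) / 2) = ((d - 1 : ℕ) : ℝ) by rw [← hd']; push_cast; ring,
    show 2 * ((d : ℝ) / 2) = (d : ℝ) by ring, rpow_natCast, rpow_natCast, ← pow_succ,
    Nat.sub_add_cancel hd]

lemma integral_neg_self_of_even {f : ℝ → ℝ} (hf : Continuous f) (heven : ∀ s, f (-s) = f s)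
    (b : ℝ) : ∫ s in (-b)..b, f s = 2 * ∫ s in (0:ℝ)..b, f s := by
  rw [← intervalIntegral.integral_add_adjacent_intervals (hf.intervalIntegrable (-b) 0)
    (hf.intervalIntegrable 0 b)]
  have h := intervalIntegral.integral_comp_neg (a := 0) (b := b) f
  simp only [heven, neg_zero] at h
  rw [← h]
  ring

/-- The Poisson integral in the variable `s = cos θ`. -/
lemma integral_cos_mul_cos_mul_sin_rpow {d : ℕ} (hd : 1 ≤ d) (r : ℝ) :
    ∫ θ in (0:ℝ)..π, cos (r * cos θ) * sin θ ^ (2 * ((d : ℝ) / 2)) =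
      2 * ∫ s in (0:ℝ)..1, besselWeight d s * cos (r * s) := by
  have hw := continuous_besselWeight hd
  have hf : Continuous fun s => besselWeight d s * cos (r * s) := by fun_prop
  rw [← integral_neg_self_of_even hf fun s => by
    rw [besselWeight_neg, mul_neg, cos_neg]]
  have h := intervalIntegral.integral_comp_mul_deriv (a := 0) (b := π)
    (fun θ _ => hasDerivAt_cos θ) (by fun_prop) hf
  rw [cos_zero, cos_pi] at h
  rw [intervalIntegral.integral_symm 1 (-1), ← h, ← intervalIntegral.integral_neg]
  refine intervalIntegral.integral_congr fun θ hθ => ?_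
  rw [Set.uIcc_of_le pi_pos.le] at hθ
  simp only [Function.comp_apply]
  rw [← besselWeight_cos_mul_sin hd (sin_nonneg_of_mem_Icc hθ)]
  ring

lemma rpow_mul_besselJ {d : ℕ} (hd : 1 ≤ d) {r : ℝ} (hr : 0 < r) :
    r ^ (-(d : ℝ) / 2) * besselJ ((d : ℝ) / 2) r =
      2 / (2 ^ ((d : ℝ) / 2) * (√π * Gamma (((d : ℝ) + 1) / 2))) *
        ∫ s in (0:ℝ)..1, besselWeight d s * cos (r * s) := by
  have h1 : r ^ (-(d : ℝ) / 2) * r ^ ((d : ℝ) / 2) = 1 := by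
    rw [← rpow_add hr, show -(d : ℝ) / 2 + (d : ℝ) / 2 = 0 by ring, rpow_zero]
  rw [besselJ, integral_cos_mul_cos_mul_sin_rpow hd, div_rpow hr.le two_pos.le,
    show (d : ℝ) / 2 + 1 / 2 = ((d : ℝ) + 1) / 2 by ring]
  have h2 : Gamma (((d : ℝ) + 1) / 2) ≠ 0 := (Gamma_pos_of_pos (by positivity)).ne'
  have h3 : (2:ℝ) ^ ((d : ℝ) / 2) ≠ 0 := by positivity
  rw [neg_div] at h1 ⊢
  field_simp
  linear_combination (∫ s in (0:ℝ)..1, besselWeight d s * cos (r * s)) * h1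

lemma integral_rpow_mul_besselJ {d : ℕ} (hd : 1 ≤ d) {a R : ℝ} (ha : 0 < a) (hR : 0 < R) :
    ∫ r in a..R, r ^ (-(d : ℝ) / 2) * besselJ ((d : ℝ) / 2) r =
      2 / (2 ^ ((d : ℝ) / 2) * (√π * Gamma (((d : ℝ) + 1) / 2))) *
        ((∫ s in (0:ℝ)..1, besselWeight d s * (R * sinc (R * s))) -
          ∫ s in (0:ℝ)..1, besselWeight d s * (a * sinc (a * s))) := by
  have hw := continuous_besselWeight hd
  rw [intervalIntegral.integral_congr (g := fun r =>
    2 / (2 ^ ((d : ℝ) / 2) * (√π * Gamma (((d : ℝ) + 1) / 2))) *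
        ∫ s in (0:ℝ)..1, besselWeight d s * cos (r * s)) fun r hr =>
    rpow_mul_besselJ hd ((lt_min ha hR).trans_le hr.1),
    intervalIntegral.integral_const_mul, intervalIntegral_intervalIntegral_swap]
  · rw [← intervalIntegral.integral_sub (Continuous.intervalIntegrable (by fun_prop) _ _)
      (Continuous.intervalIntegrable (by fun_prop) _ _)]
    simp only [intervalIntegral.integral_const_mul, integral_cos_mul_eq_sinc, mul_sub]
  · refine IntegrableOn.mono_set (t := Set.uIcc a R ×ˢ Set.uIcc 0 1) ?_
      (Set.prod_mono Set.uIoc_subset_uIcc Set.uIoc_subset_uIcc)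
    refine ContinuousOn.integrableOn_compact (isCompact_uIcc.prod isCompact_uIcc) ?_
    exact Continuous.continuousOn (by simp only [Function.uncurry_def]; fun_prop)

lemma Ifun_eq_integral_besselWeight (d : ℕ) {x : ℝ} (hx : 0 < x) :
    Ifun d x = 2 / π * ∫ s in (0:ℝ)..1,
      besselWeight d s * (2 * π * x * sinc (2 * π * x * s)) := by
  have ha : 0 < 2 * π * x := by positivity
  rw [Ifun]
  set a := 2 * π * x
  congr 1
  have h := intervalIntegral.mul_integral_comp_mul_left (a := 0) (b := 1)
    (f := fun t => (1 - (t / a) ^ 2) ^ (((d : ℝ) - 1) / 2) * (sin t / t)) a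
  rw [mul_zero, mul_one] at h
  rw [← h, ← intervalIntegral.integral_const_mul]
  refine intervalIntegral.integral_congr_ae (Eventually.of_forall fun s hs => ?_)
  rw [Set.uIoc_of_le zero_le_one] at hs
  have hs0 : a * s ≠ 0 := (mul_pos ha hs.1).ne'
  rw [sinc_of_ne_zero hs0, mul_div_cancel_left₀ _ ha.ne', besselWeight]
  ring

lemma tendsto_integral_besselWeight_mul_sinc {d : ℕ} (hd : 1 ≤ d) :
    Tendsto (fun R : ℝ => ∫ s in (0:ℝ)..1, besselWeight d s * (R * sinc (R * s))) atTop
      (𝓝 (π / 2)) := by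
  have h := (tendsto_integral_mul_sinc_sub one_pos (continuous_besselWeight hd).continuousOn
    (differentiableAt_besselWeight_zero d)).add tendsto_integral_sinc_atTop
  simpa [besselWeight_zero] using h

/-- For every integer `d ≥ 1` and every real `x > 0`, `m(x) = 1 − I(x)`. -/
theorem statement1 (d : ℕ) (hd : 1 ≤ d) (x : ℝ) (hx : 0 < x) :
    mfun d x = 1 - Ifun d x := by
  have ha : 0 < 2 * π * x := by positivity
  have hlim := ((tendsto_integral_besselWeight_mul_sinc hd).sub_const
    (∫ s in (0:ℝ)..1, besselWeight d s * (2 * π * x * sinc (2 * π * x * s)))).const_mul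
      (2 / (2 ^ ((d : ℝ) / 2) * (√π * Gamma (((d : ℝ) + 1) / 2))))
  have hlim' := hlim.congr' <| (eventually_gt_atTop (0:ℝ)).mono fun R hR =>
    (integral_rpow_mul_besselJ hd ha hR).symm
  rw [mfun, hlim'.limUnder_eq, Ifun_eq_integral_besselWeight d hx]
  generalize ∫ s in (0:ℝ)..1, besselWeight d s * (2 * π * x * sinc (2 * π * x * s)) = K
  have h2 : Gamma (((d : ℝ) + 1) / 2) ≠ 0 := (Gamma_pos_of_pos (by positivity)).ne'
  have h3 : (2:ℝ) ^ ((d : ℝ) / 2) ≠ 0 := by positivity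
  have h4 : √π ^ 2 = π := sq_sqrt pi_pos.le
  field_simp
  rw [h4]
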